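/- Fix σ ∈ ℝ and let L be as in the context. For every left 𝒜_σ-module M, dim_ℂ Hom_{𝒜_σ}(L, M) ≤ dim_ℂ M_{λ^♭}. In particular, if L is finite-dimensional and decomposes as a direct sum of simple 𝒜_σ-modules, then for any simple 𝒜_σ-module M the number of summands isomorphic to M in such a decomposition is at most dim_ℂ M_{λ^♭}. -/

import Mathlib

namespace QG

/-- Generators of the quantized universal enveloping algebra `U_q(gl(m))`:
`K i`, its inverse `Ki i`, and the Chevalley generators `E j` (the `x_j`)
and `F j` (the `y_j`).  Indices are 1-based natural numbers; out-of-range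
generators are forced to be `1` (resp. `0`) by the relations. -/
inductive Gen : Type where
  | K : ℕ → Gen
  | Ki : ℕ → Gen
  | E : ℕ → Gen
  | F : ℕ → Gen

abbrev FA := FreeAlgebra ℂ Gen

noncomputable def fK (i : ℕ) : FA := FreeAlgebra.ι ℂ (Gen.K i)
noncomputable def fKi (i : ℕ) : FA := FreeAlgebra.ι ℂ (Gen.Ki i)
noncomputable def fE (i : ℕ) : FA := FreeAlgebra.ι ℂ (Gen.E i)
noncomputable def fF (i : ℕ) : FA := FreeAlgebra.ι ℂ (Gen.F i)

/-- Kronecker delta with values in `ℤ`. -/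
def kd (i j : ℕ) : ℤ := if i = j then 1 else 0

/-- The defining relations of `U_q(gl(m))`. -/
inductive Rel (q : ℝ) (m : ℕ) : FA → FA → Prop
  | Kout : ∀ i, ¬(1 ≤ i ∧ i ≤ m) → Rel q m (fK i) 1
  | Kiout : ∀ i, ¬(1 ≤ i ∧ i ≤ m) → Rel q m (fKi i) 1
  | Eout : ∀ j, ¬(1 ≤ j ∧ j + 1 ≤ m) → Rel q m (fE j) 0
  | Fout : ∀ j, ¬(1 ≤ j ∧ j + 1 ≤ m) → Rel q m (fF j) 0
  | KK : ∀ i j, Rel q m (fK i * fK j) (fK j * fK i)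
  | KKi : ∀ i, Rel q m (fK i * fKi i) 1
  | KiK : ∀ i, Rel q m (fKi i * fK i) 1
  | KE : ∀ i j, 1 ≤ i → i ≤ m → 1 ≤ j → j + 1 ≤ m →
      Rel q m (fK i * fE j) (((q : ℂ) ^ (kd i j - kd i (j+1))) • (fE j * fK i))
  | KF : ∀ i j, 1 ≤ i → i ≤ m → 1 ≤ j → j + 1 ≤ m →
      Rel q m (fK i * fF j) (((q : ℂ) ^ (kd i (j+1) - kd i j)) • (fF j * fK i))
  | EF : ∀ i j, 1 ≤ i → i + 1 ≤ m → 1 ≤ j → j + 1 ≤ m →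
      Rel q m (fE i * fF j - fF j * fE i)
        (if i = j then ((q : ℂ) - (q : ℂ)⁻¹)⁻¹ • (fK i * fKi (i+1) - fKi i * fK (i+1)) else 0)
  | EE : ∀ i j, 1 ≤ i → i + 1 ≤ m → 1 ≤ j → j + 1 ≤ m → (i + 2 ≤ j ∨ j + 2 ≤ i) →
      Rel q m (fE i * fE j) (fE j * fE i)
  | FF : ∀ i j, 1 ≤ i → i + 1 ≤ m → 1 ≤ j → j + 1 ≤ m → (i + 2 ≤ j ∨ j + 2 ≤ i) →
      Rel q m (fF i * fF j) (fF j * fF i)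
  | Eserre : ∀ i j, 1 ≤ i → i + 1 ≤ m → 1 ≤ j → j + 1 ≤ m → (i + 1 = j ∨ j + 1 = i) →
      Rel q m (fE i ^ 2 * fE j - ((q : ℂ) + (q : ℂ)⁻¹) • (fE i * fE j * fE i) + fE j * fE i ^ 2) 0
  | Fserre : ∀ i j, 1 ≤ i → i + 1 ≤ m → 1 ≤ j → j + 1 ≤ m → (i + 1 = j ∨ j + 1 = i) →
      Rel q m (fF i ^ 2 * fF j - ((q : ℂ) + (q : ℂ)⁻¹) • (fF i * fF j * fF i) + fF j * fF i ^ 2) 0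

/-- The quantized universal enveloping algebra `U_q(gl(m))`. -/
abbrev Uq (q : ℝ) (m : ℕ) := RingQuot (Rel q m)

noncomputable def uK (q : ℝ) (m i : ℕ) : Uq q m := RingQuot.mkAlgHom ℂ (Rel q m) (fK i)
noncomputable def uKi (q : ℝ) (m i : ℕ) : Uq q m := RingQuot.mkAlgHom ℂ (Rel q m) (fKi i)
noncomputable def uE (q : ℝ) (m i : ℕ) : Uq q m := RingQuot.mkAlgHom ℂ (Rel q m) (fE i)
noncomputable def uF (q : ℝ) (m i : ℕ) : Uq q m := RingQuot.mkAlgHom ℂ (Rel q m) (fF i)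

/-- `C_i = K_i K_{2n+1-i}` in `U_q(gl(2n))`. -/
noncomputable def Cc (q : ℝ) (n i : ℕ) : Uq q (2*n) := uK q (2*n) i * uK q (2*n) (2*n+1-i)
/-- `C_i⁻¹ = K_i⁻¹ K_{2n+1-i}⁻¹` in `U_q(gl(2n))`. -/
noncomputable def Ccinv (q : ℝ) (n i : ℕ) : Uq q (2*n) := uKi q (2*n) i * uKi q (2*n) (2*n+1-i)
/-- `B_j = y_j K_{j+1}⁻¹ K_{2n-j}⁻¹ + K_j⁻¹ x_{2n-j} K_{2n-j}⁻¹` in `U_q(gl(2n))`. -/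
noncomputable def Bb (q : ℝ) (n j : ℕ) : Uq q (2*n) :=
  uF q (2*n) j * uKi q (2*n) (j+1) * uKi q (2*n) (2*n-j)
  + uKi q (2*n) j * uE q (2*n) (2*n-j) * uKi q (2*n) (2*n-j)
/-- `B_n^σ = y_n K_{n+1}⁻¹ K_n⁻¹ + K_n⁻¹ x_n K_n⁻¹ + ((q^{-σ}-q^{σ})/(q-q⁻¹)) K_n⁻²`. -/
noncomputable def Bs (q σ : ℝ) (n : ℕ) : Uq q (2*n) :=
  uF q (2*n) n * uKi q (2*n) (n+1) * uKi q (2*n) n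
  + uKi q (2*n) n * uE q (2*n) n * uKi q (2*n) n
  + (((q ^ (-σ) - q ^ σ) / (q - q⁻¹) : ℝ) : ℂ) • ((uKi q (2*n) n)^2)

/-- The generating set of the coideal subalgebra `𝒜_σ ⊆ U_q(gl(2n))`. -/
def ASet (q σ : ℝ) (n : ℕ) : Set (Uq q (2*n)) :=
  {z | (∃ i, 1 ≤ i ∧ i ≤ 2*n ∧ (z = Cc q n i ∨ z = Ccinv q n i)) ∨
       (∃ j, 1 ≤ j ∧ j + 1 ≤ 2*n ∧ j ≠ n ∧ z = Bb q n j) ∨ z = Bs q σ n}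

/-- Generators of the abstract algebra `𝒜`. -/
inductive AGen : Type where
  | g : ℕ → AGen
  | gi : ℕ → AGen
  | b : ℕ → AGen

abbrev AFA := FreeAlgebra ℂ AGen

noncomputable def fγ (i : ℕ) : AFA := FreeAlgebra.ι ℂ (AGen.g i)
noncomputable def fγi (i : ℕ) : AFA := FreeAlgebra.ι ℂ (AGen.gi i)
noncomputable def fβ (j : ℕ) : AFA := FreeAlgebra.ι ℂ (AGen.b j)

/-- `(ε_i + ε_{2n+1-i}, α_j)` where `α_j = ε_j - ε_{j+1}`. -/
def gex (n i j : ℕ) : ℤ := kd i j + kd (2*n+1-i) j - kd i (j+1) - kd (2*n+1-i) (j+1)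

/-- The defining relations of the algebra `𝒜`. -/
inductive ARel (q : ℝ) (n : ℕ) : AFA → AFA → Prop
  | gout : ∀ i, ¬(1 ≤ i ∧ i ≤ 2*n) → ARel q n (fγ i) 1
  | giout : ∀ i, ¬(1 ≤ i ∧ i ≤ 2*n) → ARel q n (fγi i) 1
  | bout : ∀ j, ¬(1 ≤ j ∧ j + 1 ≤ 2*n) → ARel q n (fβ j) 0
  | gg : ∀ i j, ARel q n (fγ i * fγ j) (fγ j * fγ i)
  | ggi : ∀ i, ARel q n (fγ i * fγi i) 1
  | gig : ∀ i, ARel q n (fγi i * fγ i) 1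
  | gsym : ∀ i, 1 ≤ i → i ≤ 2*n → ARel q n (fγ i) (fγ (2*n+1-i))
  | gb : ∀ i j, 1 ≤ i → i ≤ 2*n → 1 ≤ j → j + 1 ≤ 2*n →
      ARel q n (fγ i * fβ j) (((q : ℂ) ^ (-(gex n i j))) • (fβ j * fγ i))
  | bb : ∀ i j, 1 ≤ i → i + 1 ≤ 2*n → 1 ≤ j → j + 1 ≤ 2*n → (i + 2 ≤ j ∨ j + 2 ≤ i) →
      ARel q n (fβ i * fβ j - fβ j * fβ i)
        (if i + j = 2*n then ((q : ℂ) * ((q : ℂ) - (q : ℂ)⁻¹)⁻¹) • (fγi i ^ 2 - fγi (i+1) ^ 2)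
         else 0)
  | serre1 : ∀ i, 1 ≤ i → i + 2 ≤ 2*n →
      ARel q n
        ((q : ℂ)⁻¹ • (fβ i ^ 2 * fβ (i+1)) - ((q : ℂ) + (q : ℂ)⁻¹) • (fβ i * fβ (i+1) * fβ i)
          + (q : ℂ) • (fβ (i+1) * fβ i ^ 2))
        (if i = n then (q : ℂ) • (fβ (n+1) * fγi n ^ 2) else 0)
  | serre2 : ∀ i, 2 ≤ i → i + 1 ≤ 2*n →
      ARel q n
        ((q : ℂ) • (fβ i ^ 2 * fβ (i-1)) - ((q : ℂ) + (q : ℂ)⁻¹) • (fβ i * fβ (i-1) * fβ i)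
          + (q : ℂ)⁻¹ • (fβ (i-1) * fβ i ^ 2))
        (if i = n then (q : ℂ)⁻¹ • (fβ (n-1) * fγi n ^ 2) else 0)

/-- The abstract algebra `𝒜`. -/
abbrev Aalg (q : ℝ) (n : ℕ) := RingQuot (ARel q n)

noncomputable def aγ (q : ℝ) (n i : ℕ) : Aalg q n := RingQuot.mkAlgHom ℂ (ARel q n) (fγ i)
noncomputable def aγi (q : ℝ) (n i : ℕ) : Aalg q n := RingQuot.mkAlgHom ℂ (ARel q n) (fγi i)
noncomputable def aβ (q : ℝ) (n j : ℕ) : Aalg q n := RingQuot.mkAlgHom ℂ (ARel q n) (fβ j)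

end QG

namespace QG

/-- The space `Hom_{𝒜_σ}(L,M)` of intertwiners, as a subspace of `L →ₗ[ℂ] M`. -/
noncomputable def homSub (q : ℝ) (n : ℕ) (L M : Type)
    [AddCommGroup L] [Module ℂ L] [AddCommGroup M] [Module ℂ M]
    (πσ : Aalg q n →ₐ[ℂ] Uq q (2*n))
    (ρL : Uq q (2*n) →ₐ[ℂ] Module.End ℂ L) (ρM : Aalg q n →ₐ[ℂ] Module.End ℂ M) :
    Submodule ℂ (L →ₗ[ℂ] M) where
  carrier := {φ | ∀ (a : Aalg q n) (v : L), φ (ρL (πσ a) v) = ρM a (φ v)}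
  add_mem' := by
    intro f g hf hg a v
    simp only [LinearMap.add_apply, map_add, hf a v, hg a v]
  zero_mem' := by intro a v; simp
  smul_mem' := by
    intro c f hf a v
    simp only [LinearMap.smul_apply, map_smul, hf a v]

/-- The weight space `M_w = {m ∈ M : C_i m = q^{w_i} m, i = 1,…,n}`. -/
noncomputable def flatSub (q : ℝ) (n : ℕ) (M : Type) [AddCommGroup M] [Module ℂ M]
    (ρM : Aalg q n →ₐ[ℂ] Module.End ℂ M) (w : ℕ → ℤ) : Submodule ℂ M where
  carrier := {m | ∀ i, 1 ≤ i → i ≤ n → ρM (aγ q n i) m = ((q : ℂ) ^ (w i)) • m}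
  add_mem' := by
    intro f g hf hg i h1 h2
    simp only [map_add, hf i h1 h2, hg i h1 h2, smul_add]
  zero_mem' := by intro i h1 h2; simp
  smul_mem' := by
    intro c m hm i h1 h2
    simp only [map_smul, hm i h1 h2]
    rw [smul_comm]

end QG

namespace QG

section Relations

variable {q : ℝ} {m : ℕ}

theorem uKi_mul_uK (i : ℕ) : uKi q m i * uK q m i = 1 := by
  simpa [uK, uKi] using RingQuot.mkAlgHom_rel ℂ (Rel.KiK (q := q) (m := m) i)

theorem uK_mul_uF {i j : ℕ} (hi : 1 ≤ i) (him : i ≤ m) (hj : 1 ≤ j) (hjm : j + 1 ≤ m) :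
    uK q m i * uF q m j = ((q : ℂ) ^ (kd i (j + 1) - kd i j)) • (uF q m j * uK q m i) := by
  simpa [uK, uF] using RingQuot.mkAlgHom_rel ℂ (Rel.KF (q := q) i j hi him hj hjm)

theorem uE_mul_uF {i j : ℕ} (hi : 1 ≤ i) (him : i + 1 ≤ m) (hj : 1 ≤ j) (hjm : j + 1 ≤ m) :
    uE q m i * uF q m j = uF q m j * uE q m i +
      if i = j then ((q : ℂ) - (q : ℂ)⁻¹)⁻¹ •
        (uK q m i * uKi q m (i + 1) - uKi q m i * uK q m (i + 1)) else 0 := by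
  have h := RingQuot.mkAlgHom_rel ℂ (Rel.EF (q := q) i j hi him hj hjm)
  rw [← sub_eq_iff_eq_add']
  split_ifs with hij
  · simpa [uK, uKi, uE, uF, hij] using h
  · simpa [uE, uF, hij] using h

end Relations

section Words

variable {q : ℝ} {m : ℕ} {L : Type} [AddCommGroup L] [Module ℂ L]
  (ρ : Uq q m →ₐ[ℂ] Module.End ℂ L) (v : L)

/-- The vector `y_{j_1} ⋯ y_{j_r} v` attached to the list `j_1, …, j_r`. -/
noncomputable def fWord (l : List ℕ) : L := l.foldr (fun j u => ρ (uF q m j) u) v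

/-- The span of the vectors `y_{j_1} ⋯ y_{j_r} v` with `r < k`. -/
noncomputable def fWordSpan (k : ℕ) : Submodule ℂ L :=
  Submodule.span ℂ {z | ∃ l : List ℕ, (∀ j ∈ l, 1 ≤ j ∧ j + 1 ≤ m) ∧ l.length < k ∧
    z = fWord ρ v l}

variable {ρ v}

theorem fWord_mem_fWordSpan {l : List ℕ} (hl : ∀ j ∈ l, 1 ≤ j ∧ j + 1 ≤ m) {k : ℕ}
    (hk : l.length < k) : fWord ρ v l ∈ fWordSpan ρ v k :=
  Submodule.subset_span ⟨l, hl, hk, rfl⟩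

theorem fWordSpan_le_comap {k : ℕ} {P : Submodule ℂ L} (T : Module.End ℂ L)
    (h : ∀ l : List ℕ, (∀ j ∈ l, 1 ≤ j ∧ j + 1 ≤ m) → l.length < k → T (fWord ρ v l) ∈ P) :
    fWordSpan ρ v k ≤ P.comap T :=
  Submodule.span_le.2 fun _ ⟨l, hl, hk, hz⟩ => hz ▸ h l hl hk

theorem uF_apply_mem_fWordSpan {j : ℕ} (hj : 1 ≤ j) (hjm : j + 1 ≤ m) {k : ℕ} {u : L}
    (hu : u ∈ fWordSpan ρ v k) : ρ (uF q m j) u ∈ fWordSpan ρ v (k + 1) := by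
  refine fWordSpan_le_comap (P := fWordSpan ρ v (k + 1)) (ρ (uF q m j)) (fun l hl hk => ?_) hu
  refine fWord_mem_fWordSpan (l := j :: l) ?_ (by simpa using hk)
  intro i hi
  rcases List.mem_cons.1 hi with rfl | hi
  exacts [⟨hj, hjm⟩, hl i hi]

variable {lam : ℕ → ℤ}

theorem exists_uK_fWord
    (hK : ∀ i, 1 ≤ i → i ≤ m → ρ (uK q m i) v = ((q : ℂ) ^ (lam i)) • v)
    (hq : q ≠ 0) {i : ℕ} (hi : 1 ≤ i) (him : i ≤ m) {l : List ℕ}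
    (hl : ∀ j ∈ l, 1 ≤ j ∧ j + 1 ≤ m) :
    ∃ c : ℂ, c ≠ 0 ∧ ρ (uK q m i) (fWord ρ v l) = c • fWord ρ v l ∧
      ρ (uKi q m i) (fWord ρ v l) = c⁻¹ • fWord ρ v l := by
  have hqC : (q : ℂ) ≠ 0 := by exact_mod_cast hq
  suffices h : ∃ c : ℂ, c ≠ 0 ∧ ρ (uK q m i) (fWord ρ v l) = c • fWord ρ v l by
    obtain ⟨c, hc, h⟩ := h
    refine ⟨c, hc, h, ?_⟩
    have hinv : ρ (uKi q m i) (ρ (uK q m i) (fWord ρ v l)) = fWord ρ v l := by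
      rw [← Module.End.mul_apply, ← map_mul, uKi_mul_uK, map_one, Module.End.one_apply]
    rw [h, map_smul] at hinv
    rw [eq_inv_smul_iff₀ hc, hinv]
  induction l with
  | nil => exact ⟨_, zpow_ne_zero _ hqC, hK i hi him⟩
  | cons j l ih =>
    obtain ⟨c, hc, h⟩ := ih fun i hi => hl i (List.mem_cons_of_mem _ hi)
    obtain ⟨hj, hjm⟩ := hl j List.mem_cons_self
    refine ⟨(q : ℂ) ^ (kd i (j + 1) - kd i j) * c, mul_ne_zero (zpow_ne_zero _ hqC) hc, ?_⟩
    change ρ (uK q m i) (ρ (uF q m j) (fWord ρ v l)) = _ • ρ (uF q m j) (fWord ρ v l)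
    rw [← Module.End.mul_apply, ← map_mul, uK_mul_uF hi him hj hjm, map_smul, map_mul,
      LinearMap.smul_apply, Module.End.mul_apply, h, map_smul, smul_smul]

theorem uKi_apply_mem_fWordSpan
    (hK : ∀ i, 1 ≤ i → i ≤ m → ρ (uK q m i) v = ((q : ℂ) ^ (lam i)) • v)
    (hq : q ≠ 0) {i : ℕ} (hi : 1 ≤ i) (him : i ≤ m) {k : ℕ} {u : L}
    (hu : u ∈ fWordSpan ρ v k) : ρ (uKi q m i) u ∈ fWordSpan ρ v k := by
  refine fWordSpan_le_comap (P := fWordSpan ρ v k) (ρ (uKi q m i)) (fun l hl hk => ?_) hu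
  obtain ⟨c, -, -, h⟩ := exists_uK_fWord hK hq hi him hl
  rw [h]
  exact Submodule.smul_mem _ _ (fWord_mem_fWordSpan hl hk)

theorem uE_fWord_mem_fWordSpan
    (hK : ∀ i, 1 ≤ i → i ≤ m → ρ (uK q m i) v = ((q : ℂ) ^ (lam i)) • v)
    (hq : q ≠ 0)
    (hx : ∀ j, 1 ≤ j → j + 1 ≤ m → ρ (uE q m j) v = 0)
    {i : ℕ} (hi : 1 ≤ i) (him : i + 1 ≤ m) {l : List ℕ}
    (hl : ∀ j ∈ l, 1 ≤ j ∧ j + 1 ≤ m) :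
    ρ (uE q m i) (fWord ρ v l) ∈ fWordSpan ρ v l.length := by
  induction l with
  | nil =>
    change ρ (uE q m i) v ∈ _
    rw [hx i hi him]
    exact zero_mem _
  | cons j l ih =>
    have hl' : ∀ j ∈ l, 1 ≤ j ∧ j + 1 ≤ m := fun i hi => hl i (List.mem_cons_of_mem _ hi)
    obtain ⟨hj, hjm⟩ := hl j List.mem_cons_self
    change ρ (uE q m i) (ρ (uF q m j) (fWord ρ v l)) ∈ _
    rw [← Module.End.mul_apply, ← map_mul, uE_mul_uF hi him hj hjm, map_add, map_mul,
      LinearMap.add_apply, Module.End.mul_apply]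
    refine add_mem (uF_apply_mem_fWordSpan hj hjm (ih hl')) ?_
    have hw : fWord ρ v l ∈ fWordSpan ρ v (j :: l).length :=
      fWord_mem_fWordSpan hl' (by simp)
    split_ifs
    · obtain ⟨c, -, hc, hc'⟩ := exists_uK_fWord hK hq hi (by omega : i ≤ m) hl'
      obtain ⟨d, -, hd, hd'⟩ := exists_uK_fWord hK hq (by omega : 1 ≤ i + 1) him hl'
      simp only [map_smul, map_sub, map_mul, LinearMap.smul_apply, LinearMap.sub_apply,
        Module.End.mul_apply, hc, hc', hd, hd']
      exact Submodule.smul_mem _ _ (sub_mem (Submodule.smul_mem _ _ (Submodule.smul_mem _ _ hw))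
        (Submodule.smul_mem _ _ (Submodule.smul_mem _ _ hw)))
    · simp

end Words

section Cyclic

variable {q σ : ℝ} {n : ℕ} {L : Type} [AddCommGroup L] [Module ℂ L]
  {ρ : Uq q (2 * n) →ₐ[ℂ] Module.End ℂ L} {v : L} {lam : ℕ → ℤ}

/-- A subspace that contains the highest weight vector and is stable under the elements `B_j`,
`B_n^σ` contains every vector `y_{j_1} ⋯ y_{j_r} v`. -/
theorem fWord_mem_of_stable (hq : q ≠ 0)
    (hK : ∀ i, 1 ≤ i → i ≤ 2 * n → ρ (uK q (2 * n) i) v = ((q : ℂ) ^ (lam i)) • v)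
    (hx : ∀ j, 1 ≤ j → j + 1 ≤ 2 * n → ρ (uE q (2 * n) j) v = 0)
    {P : Submodule ℂ L} (hv : v ∈ P)
    (hB : ∀ j, 1 ≤ j → j + 1 ≤ 2 * n → j ≠ n → ∀ u ∈ P, ρ (Bb q n j) u ∈ P)
    (hBn : ∀ u ∈ P, ρ (Bs q σ n) u ∈ P) {l : List ℕ}
    (hl : ∀ j ∈ l, 1 ≤ j ∧ j + 1 ≤ 2 * n) : fWord ρ v l ∈ P := by
  induction hr : l.length using Nat.strong_induction_on generalizing l with
  | _ r ih =>
  cases l with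
  | nil => exact hv
  | cons j l =>
    have hl' : ∀ j ∈ l, 1 ≤ j ∧ j + 1 ≤ 2 * n := fun i hi => hl i (List.mem_cons_of_mem _ hi)
    obtain ⟨hj, hjm⟩ := hl j List.mem_cons_self
    have hr' : l.length < r := by simp [← hr]
    have hw : fWord ρ v l ∈ P := ih _ hr' hl' rfl
    have hle : fWordSpan ρ v l.length ≤ P :=
      Submodule.span_le.2 fun _ ⟨l₁, hl₁, hk, hz⟩ => hz ▸ ih _ (hk.trans hr') hl₁ rfl
    obtain ⟨b, hb, -, hb'⟩ := exists_uK_fWord hK hq (by omega : 1 ≤ j + 1) hjm hl'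
    obtain ⟨c, hc, -, hc'⟩ := exists_uK_fWord hK hq (by omega : 1 ≤ 2 * n - j)
      (by omega : 2 * n - j ≤ 2 * n) hl'
    have hE : ρ (uKi q (2 * n) j) (ρ (uE q (2 * n) (2 * n - j)) (fWord ρ v l)) ∈ P :=
      hle (uKi_apply_mem_fWordSpan hK hq hj (by omega)
        (uE_fWord_mem_fWordSpan hK hq hx (by omega) (by omega) hl'))
    suffices h : c⁻¹ • b⁻¹ • ρ (uF q (2 * n) j) (fWord ρ v l) ∈ P by
      rwa [Submodule.smul_mem_iff _ (inv_ne_zero hc), Submodule.smul_mem_iff _ (inv_ne_zero hb)]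
        at h
    by_cases hjn : j = n
    · subst hjn
      have h := hBn _ hw
      rw [show 2 * j - j = j by omega] at hE hc'
      simp only [Bs, pow_two, map_add, map_mul, map_smul, LinearMap.add_apply,
        LinearMap.smul_apply, Module.End.mul_apply, hb', hc'] at h
      rwa [add_assoc, Submodule.add_mem_iff_left] at h
      exact add_mem (Submodule.smul_mem _ _ hE) (Submodule.smul_mem _ _ (Submodule.smul_mem _ _
        (Submodule.smul_mem _ _ hw)))
    · have h := hB j hj hjm hjn _ hw
      simp only [Bb, map_add, map_mul, map_smul, LinearMap.add_apply,
        Module.End.mul_apply, hb', hc'] at h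
      rwa [Submodule.add_mem_iff_left] at h
      exact Submodule.smul_mem _ _ hE

end Cyclic

section Multiplicity

variable {q : ℝ} {n : ℕ} {L M : Type} [AddCommGroup L] [Module ℂ L] [AddCommGroup M] [Module ℂ M]
  {πσ : Aalg q n →ₐ[ℂ] Uq q (2 * n)} {ρL : Uq q (2 * n) →ₐ[ℂ] Module.End ℂ L}
  {ρM : Aalg q n →ₐ[ℂ] Module.End ℂ M}

/-- In a direct sum decomposition into stable subspaces, the number of summands isomorphic to a
nonzero module `M` is at most the dimension of the space of intertwiners to `M`. -/
theorem card_le_rank_homSub {m : M} (hm : m ≠ 0) {N : ℕ} {W : Fin N → Submodule ℂ L}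
    (hW : DirectSum.IsInternal W) (hstab : ∀ j (a : Aalg q n) v, v ∈ W j → ρL (πσ a) v ∈ W j)
    (S : Finset (Fin N))
    (hS : ∀ j ∈ S, ∃ e : ↥(W j) ≃ₗ[ℂ] M,
      ∀ (a : Aalg q n) (v : ↥(W j)) (h : ρL (πσ a) (v : L) ∈ W j),
        e ⟨ρL (πσ a) (v : L), h⟩ = ρM a (e v)) :
    (S.card : Cardinal) ≤ Module.rank ℂ ↥(homSub q n L M πσ ρL ρM) := by
  let D : (DirectSum (Fin N) fun j => ↥(W j)) ≃ₗ[ℂ] L :=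
    LinearEquiv.ofBijective (DirectSum.coeLinearMap W) hW
  have hD : ∀ k (w : W k), D.symm (w : L) = DirectSum.lof ℂ (Fin N) (fun j => ↥(W j)) k w := by
    intro k w
    rw [LinearEquiv.symm_apply_eq]
    exact (DirectSum.coeLinearMap_lof W k w).symm
  choose e he using fun j : S => hS j j.2
  let φ : S → (L →ₗ[ℂ] M) := fun j =>
    (e j).toLinearMap ∘ₗ DirectSum.component ℂ (Fin N) (fun j => ↥(W j)) j ∘ₗ D.symm.toLinearMap
  have hself : ∀ (j : S) (w : W j), φ j w = e j w := by
    intro j w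
    simp [φ, hD, DirectSum.component.lof_self]
  have hne : ∀ (j : S) (k : Fin N) (w : W k), k ≠ j → φ j w = 0 := by
    intro j k w hk
    simp [φ, hD, DirectSum.component.of, hk]
  have hφ : ∀ j, φ j ∈ homSub q n L M πσ ρL ρM := by
    intro j a u
    obtain ⟨x, rfl⟩ := D.surjective u
    induction x using DirectSum.induction_on with
    | zero => simp
    | add x y hx hy => simp only [map_add, hx, hy]
    | of k w =>
      have hDw : D (DirectSum.of (fun j => ↥(W j)) k w) = (w : L) :=
        DirectSum.coeLinearMap_lof W k w
      rw [hDw]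
      by_cases hk : k = j
      · subst hk
        rw [hself j w, ← he j a w (hstab _ a _ w.2)]
        exact hself j ⟨_, hstab _ a _ w.2⟩
      · rw [hne j k w hk, map_zero]
        exact hne j k ⟨_, hstab k a _ w.2⟩ hk
  have hli : LinearIndependent ℂ
      fun j => (⟨φ j, hφ j⟩ : homSub q n L M πσ ρL ρM) := by
    refine LinearIndependent.of_comp (homSub q n L M πσ ρL ρM).subtype ?_
    rw [Fintype.linearIndependent_iff]
    intro g hg k
    have h := LinearMap.congr_fun hg ((e k).symm m : L)
    rw [LinearMap.sum_apply, Finset.sum_eq_single k] at h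
    · have h' : g k • φ k ((e k).symm m : L) = 0 := h
      rw [hself, LinearEquiv.apply_symm_apply] at h'
      exact (smul_eq_zero.1 h').resolve_right hm
    · intro j _ hjk
      change g j • φ j ((e k).symm m : L) = 0
      rw [hne j k _ fun hkj => hjk (Subtype.ext hkj.symm), smul_zero]
    · simp
  simpa using hli.cardinal_le_rank

/-- If `v` generates `L`, then evaluation at `v` embeds the space of intertwiners into any
subspace that contains the values at `v`. -/
theorem rank_homSub_le {v : L} (hgen : ∀ u : L, ∃ a, ρL (πσ a) v = u) {P : Submodule ℂ M}
    (hP : ∀ φ ∈ homSub q n L M πσ ρL ρM, φ v ∈ P) :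
    Module.rank ℂ ↥(homSub q n L M πσ ρL ρM) ≤ Module.rank ℂ ↥P := by
  let ev : homSub q n L M πσ ρL ρM →ₗ[ℂ] P :=
    ((LinearMap.applyₗ v).domRestrict _).codRestrict P fun φ => hP φ φ.2
  refine LinearMap.rank_le_of_injective ev ?_
  rw [injective_iff_map_eq_zero]
  intro φ h
  have h0 : φ.1 v = 0 := congrArg Subtype.val h
  ext u
  obtain ⟨a, rfl⟩ := hgen u
  rw [φ.2 a v, h0, map_zero]
  rfl

end Multiplicity

end QG

open QG in
/-- `dim_ℂ Hom_{𝒜_σ}(L,M) ≤ dim_ℂ M_{λ♭}`; in particular, if `L` is finite-dimensional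
and decomposes as a direct sum of simple `𝒜_σ`-modules, then for any simple
`𝒜_σ`-module `M` the number of summands isomorphic to `M` is at most `dim_ℂ M_{λ♭}`. -/
theorem statement_12 (q : ℝ) (hq0 : 0 < q) (hq1 : q < 1) (n : ℕ) (hn : 1 ≤ n) (σ : ℝ)
    (πσ : Aalg q n →ₐ[ℂ] Uq q (2*n))
    (hπσγ : ∀ i, 1 ≤ i → i ≤ 2*n →
      πσ (aγ q n i) = Cc q n i ∧ πσ (aγi q n i) = Ccinv q n i)
    (hπσβ : ∀ j, 1 ≤ j → j + 1 ≤ 2*n → j ≠ n → πσ (aβ q n j) = Bb q n j)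
    (hπσn : πσ (aβ q n n) = Bs q σ n)
    (L M : Type) [AddCommGroup L] [Module ℂ L] [AddCommGroup M] [Module ℂ M]
    (ρL : Uq q (2*n) →ₐ[ℂ] Module.End ℂ L)
    (ρM : Aalg q n →ₐ[ℂ] Module.End ℂ M)
    (lam : ℕ → ℤ) (vlam : L) (hv0 : vlam ≠ 0)
    (hK : ∀ i, 1 ≤ i → i ≤ 2*n → ρL (uK q (2*n) i) vlam = ((q : ℂ) ^ (lam i)) • vlam)
    (hx : ∀ j, 1 ≤ j → j + 1 ≤ 2*n → ρL (uE q (2*n) j) vlam = 0)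
    (hspan : Submodule.span ℂ
      {z : L | ∃ l : List ℕ, (∀ j ∈ l, 1 ≤ j ∧ j + 1 ≤ 2*n) ∧
        z = l.foldr (fun j u => ρL (uF q (2*n) j) u) vlam} = ⊤) :
    Module.rank ℂ ↥(homSub q n L M πσ ρL ρM) ≤
      Module.rank ℂ ↥(flatSub q n M ρM (fun i => lam i + lam (2*n+1-i))) ∧
    (FiniteDimensional ℂ L →
      (∃ m : M, m ≠ 0) →
      (∀ p : Submodule ℂ M, (∀ (a : Aalg q n) m, m ∈ p → ρM a m ∈ p) → p = ⊥ ∨ p = ⊤) →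
      ∀ (N : ℕ) (W : Fin N → Submodule ℂ L),
        DirectSum.IsInternal W →
        (∀ j (a : Aalg q n) v, v ∈ W j → ρL (πσ a) v ∈ W j) →
        (∀ j, W j ≠ ⊥ ∧ ∀ p : Submodule ℂ L, p ≤ W j →
            (∀ (a : Aalg q n) v, v ∈ p → ρL (πσ a) v ∈ p) → p = ⊥ ∨ p = W j) →
        ∀ S : Finset (Fin N),
          (∀ j ∈ S, ∃ e : ↥(W j) ≃ₗ[ℂ] M,
            ∀ (a : Aalg q n) (v : ↥(W j)) (h : ρL (πσ a) (v : L) ∈ W j),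
              e ⟨ρL (πσ a) (v : L), h⟩ = ρM a (e v)) →
          (S.card : Cardinal) ≤
            Module.rank ℂ ↥(flatSub q n M ρM (fun i => lam i + lam (2*n+1-i)))) := by
  have hq : q ≠ 0 := hq0.ne'
  have hqC : (q : ℂ) ≠ 0 := by exact_mod_cast hq
  have hgen : ∀ u : L, ∃ a, ρL (πσ a) vlam = u := by
    let T : Aalg q n →ₗ[ℂ] L :=
      LinearMap.applyₗ vlam ∘ₗ ρL.toLinearMap ∘ₗ πσ.toLinearMap
    have hT : ∀ a, T a = ρL (πσ a) vlam := fun _ => rfl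
    have hstab : ∀ a, ∀ u ∈ LinearMap.range T, ρL (πσ a) u ∈ LinearMap.range T := by
      rintro a _ ⟨b, rfl⟩
      exact ⟨a * b, by simp [hT]⟩
    have htop : ⊤ ≤ LinearMap.range T := by
      rw [← hspan, Submodule.span_le]
      rintro _ ⟨l, hl, rfl⟩
      refine fWord_mem_of_stable (σ := σ) hq hK hx (LinearMap.mem_range.2 ⟨1, by simp [hT]⟩) ?_ ?_ hl
      · intro j hj hjm hjn
        rw [← hπσβ j hj hjm hjn]
        exact hstab _
      · rw [← hπσn]
        exact hstab _
    exact fun u => htop (Submodule.mem_top (x := u))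
  have hrank : Module.rank ℂ ↥(homSub q n L M πσ ρL ρM) ≤
      Module.rank ℂ ↥(flatSub q n M ρM (fun i => lam i + lam (2*n+1-i))) := by
    refine rank_homSub_le hgen fun φ hφ i hi hin => ?_
    rw [← hφ, (hπσγ i hi (by omega)).1, Cc, map_mul, Module.End.mul_apply,
      hK (2*n+1-i) (by omega) (by omega), map_smul, hK i hi (by omega), smul_smul, map_smul,
      zpow_add₀ hqC, mul_comm]
  refine ⟨hrank, ?_⟩
  rintro - ⟨m, hm⟩ - N W hW hstab - S hS
  exact (card_le_rank_homSub hm hW hstab S hS).trans hrank
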